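/- arXiv:2005.06673 — 5 statements merged into one kernel-verified Lean document; each statement's English description precedes it below -/
import Mathlib

section
/- Let X and Y be nonempty finite sets and ζ a probability distribution on X. For two channels Q₁, Q₂ (stochastic kernels from X to Y, i.e., for each x ∈ X a probability distribution Qᵢ(·|x) on Y), the following are equivalent: (i) Q₂ is stochastically degraded with respect to Q₁, i.e., there exists a stochastic kernel Q′ from Y to Y such that Q₂(y′|x) = Σ_{y ∈ Y} Q′(y′|y) Q₁(y|x) for every y′ ∈ Y and every x ∈ X with ζ(x) > 0; (ii) for every nonempty finite action set U and every cost function c : X × U → ℝ, min over maps γ : Y → U of Σ_{x,y} ζ(x) Q₁(y|x) c(x, γ(y)) is less than or equal to min over maps γ : Y → U of Σ_{x,y} ζ(x) Q₂(y|x) c(x, γ(y)). -/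
/-- A linear functional on `X → Y → ℝ` is the pairing with its matrix of coefficients. -/
lemma linearMap_apply_eq_sum_single {X Y : Type*} [Fintype X] [Fintype Y]
    [DecidableEq X] [DecidableEq Y] (f : (X → Y → ℝ) →ₗ[ℝ] ℝ) (g : X → Y → ℝ) :
    f g = ∑ x, ∑ y, g x y * f (Pi.single x (Pi.single y 1)) := by
  have hg : g = ∑ x, ∑ y, g x y • (Pi.single x (Pi.single y 1) : X → Y → ℝ) := by
    ext a b
    simp [Finset.sum_apply, Pi.single_apply, ite_apply]
  conv_lhs => rw [hg]
  simp [map_sum]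

/-- The channel `Q` followed by a kernel on `Y`, with each row `x` scaled by `w x`, as a linear map
in the kernel on `Y`. -/
def weightedComp {X Y : Type*} [Fintype Y] (w : X → ℝ) (Q : X → Y → ℝ) :
    (Y → Y → ℝ) →ₗ[ℝ] (X → Y → ℝ) where
  toFun Q' x y' := w x * ∑ y, Q' y y' * Q x y
  map_add' A B := by
    ext x y'
    simp [add_mul, Finset.sum_add_distrib, mul_add]
  map_smul' r A := by
    ext x y'
    simp only [Pi.smul_apply, smul_eq_mul, RingHom.id_apply, Finset.mul_sum]
    exact Finset.sum_congr rfl fun _ _ => by ring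

/-- Garbling cannot help: any decision rule applied to the garbled observation is matched by a
deterministic rule applied to the original one. -/
lemma exists_rule_cost_le_of_garbling {X Y U : Type*} [Fintype X] [Fintype Y]
    [Fintype U] [Nonempty U] (w : X → ℝ) (Q₁ Q₂ : X → Y → ℝ) (Q' : Y → Y → ℝ)
    (hQ'0 : ∀ y y', 0 ≤ Q' y y') (hQ'1 : ∀ y, ∑ y', Q' y y' = 1)
    (hQ : ∀ x y', w x * Q₂ x y' = w x * ∑ y, Q' y y' * Q₁ x y)
    (c : X → U → ℝ) (γ₂ : Y → U) :
    ∃ γ₁ : Y → U, ∑ x, ∑ y, w x * Q₁ x y * c x (γ₁ y) ≤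
      ∑ x, ∑ y, w x * Q₂ x y * c x (γ₂ y) := by
  have hmin : ∀ y, ∃ u, ∀ v, ∑ x, w x * Q₁ x y * c x u ≤ ∑ x, w x * Q₁ x y * c x v :=
    fun y => Finite.exists_min fun u => ∑ x, w x * Q₁ x y * c x u
  choose γ₁ hγ₁ using hmin
  refine ⟨γ₁, ?_⟩
  calc ∑ x, ∑ y, w x * Q₁ x y * c x (γ₁ y)
      = ∑ y, ∑ y', Q' y y' * ∑ x, w x * Q₁ x y * c x (γ₁ y) := by
        rw [Finset.sum_comm]
        refine Finset.sum_congr rfl fun y _ => ?_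
        rw [← Finset.sum_mul, hQ'1, one_mul]
    _ ≤ ∑ y, ∑ y', Q' y y' * ∑ x, w x * Q₁ x y * c x (γ₂ y') :=
        Finset.sum_le_sum fun y _ => Finset.sum_le_sum fun y' _ =>
          mul_le_mul_of_nonneg_left (hγ₁ y _) (hQ'0 y y')
    _ = ∑ x, ∑ y', w x * Q₂ x y' * c x (γ₂ y') := by
        simp only [hQ, Finset.mul_sum, Finset.sum_mul]
        rw [Finset.sum_comm, Finset.sum_comm (s := (Finset.univ : Finset X))]
        refine Finset.sum_congr rfl fun y' _ => ?_
        rw [Finset.sum_comm]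
        exact Finset.sum_congr rfl fun x _ => Finset.sum_congr rfl fun y _ => by ring

/-- If `w • Q₂` is not a weighted garbling of `Q₁`, then some cost function with actions in `Y`
separates it strictly from all deterministic rules applied to `Q₁`. -/
lemma exists_cost_separating {X Y : Type*} [Fintype X] [Fintype Y]
    (w : X → ℝ) (Q₁ Q₂ : X → Y → ℝ)
    (h : (fun x y => w x * Q₂ x y) ∉
      weightedComp w Q₁ '' Set.univ.pi fun _ : Y => stdSimplex ℝ Y) :
    ∃ (c : X → Y → ℝ) (r : ℝ), ∑ x, ∑ y, w x * Q₂ x y * c x y < r ∧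
      ∀ γ : Y → Y, r < ∑ x, ∑ y, w x * Q₁ x y * c x (γ y) := by
  classical
  have hconv : Convex ℝ (weightedComp w Q₁ '' Set.univ.pi fun _ : Y => stdSimplex ℝ Y) :=
    (convex_pi fun _ _ => convex_stdSimplex ℝ Y).linear_image _
  have hclosed : IsClosed (weightedComp w Q₁ '' Set.univ.pi fun _ : Y => stdSimplex ℝ Y) :=
    ((isCompact_univ_pi fun _ => isCompact_stdSimplex ℝ Y).image
      (LinearMap.continuous_of_finiteDimensional _)).isClosed
  obtain ⟨f, r, hlt, hgt⟩ := geometric_hahn_banach_point_closed hconv hclosed h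
  have hf : ∀ g, f g = ∑ x, ∑ y, g x y * f (Pi.single x (Pi.single y 1)) :=
    linearMap_apply_eq_sum_single f.toLinearMap
  refine ⟨fun x y => f (Pi.single x (Pi.single y 1)), r, by rwa [hf] at hlt, fun γ => ?_⟩
  have hγ := hgt _ ⟨fun y => Pi.single (γ y) 1, fun y _ => single_mem_stdSimplex ℝ (γ y), rfl⟩
  rw [hf] at hγ
  refine hγ.trans_eq (Finset.sum_congr rfl fun x _ => ?_)
  simp only [weightedComp, LinearMap.coe_mk, AddHom.coe_mk, Finset.mul_sum, Finset.sum_mul]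
  rw [Finset.sum_comm]
  refine Finset.sum_congr rfl fun y _ => ?_
  simp [Pi.single_apply]


/-- Blackwell's theorem for finite spaces with a fixed prior `ζ`:
`Q₂` is stochastically degraded with respect to `Q₁` (a garbling) iff for every finite
action set and every cost function, the optimal expected cost under `Q₁` is at most
that under `Q₂`. -/
theorem blackwell_finite
    {X Y : Type} [Fintype X] [Nonempty X] [Fintype Y] [Nonempty Y]
    (ζ : X → ℝ) (hζ0 : ∀ x, 0 ≤ ζ x) (hζ1 : ∑ x, ζ x = 1)
    (Q₁ Q₂ : X → Y → ℝ)
    (hQ₁0 : ∀ x y, 0 ≤ Q₁ x y) (hQ₁1 : ∀ x, ∑ y, Q₁ x y = 1)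
    (hQ₂0 : ∀ x y, 0 ≤ Q₂ x y) (hQ₂1 : ∀ x, ∑ y, Q₂ x y = 1) :
    (∃ Q' : Y → Y → ℝ, (∀ y y', 0 ≤ Q' y y') ∧ (∀ y, ∑ y', Q' y y' = 1) ∧
      (∀ x, 0 < ζ x → ∀ y', Q₂ x y' = ∑ y, Q' y y' * Q₁ x y))
    ↔
    (∀ (U : Type) [Fintype U] [Nonempty U], ∀ c : X → U → ℝ,
      (⨅ γ : Y → U, ∑ x, ∑ y, ζ x * Q₁ x y * c x (γ y)) ≤
        ⨅ γ : Y → U, ∑ x, ∑ y, ζ x * Q₂ x y * c x (γ y)) := by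
  constructor
  · rintro ⟨Q', hQ'0, hQ'1, hQ⟩ U _ _ c
    refine le_ciInf fun γ₂ => ?_
    have hw : ∀ x y', ζ x * Q₂ x y' = ζ x * ∑ y, Q' y y' * Q₁ x y := by
      intro x y'
      rcases (hζ0 x).eq_or_lt with hx | hx
      · simp [← hx]
      · rw [hQ x hx y']
    obtain ⟨γ₁, hγ₁⟩ := exists_rule_cost_le_of_garbling ζ Q₁ Q₂ Q' hQ'0 hQ'1 hw c γ₂
    exact (ciInf_le (Set.finite_range _).bddBelow γ₁).trans hγ₁
  · intro h
    by_cases hT : (fun x y => ζ x * Q₂ x y) ∈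
        weightedComp ζ Q₁ '' Set.univ.pi fun _ : Y => stdSimplex ℝ Y
    · obtain ⟨Q', hQ', hEq⟩ := hT
      refine ⟨Q', fun y => (hQ' y trivial).1, fun y => (hQ' y trivial).2, fun x hx y' => ?_⟩
      exact mul_left_cancel₀ hx.ne' (congrFun (congrFun hEq x) y').symm
    · obtain ⟨c, r, hlt, hgt⟩ := exists_cost_separating ζ Q₁ Q₂ hT
      have h₁ : r ≤ ⨅ γ : Y → Y, ∑ x, ∑ y, ζ x * Q₁ x y * c x (γ y) :=
        le_ciInf fun γ => (hgt γ).le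
      have h₂ : (⨅ γ : Y → Y, ∑ x, ∑ y, ζ x * Q₂ x y * c x (γ y)) ≤
          ∑ x, ∑ y, ζ x * Q₂ x y * c x y :=
        ciInf_le (Set.finite_range _).bddBelow id
      exact absurd ((h₁.trans (h Y c)).trans h₂) hlt.not_ge
end

section
/- Let X and Y be standard Borel spaces, ζ a Borel probability measure on X, and let μ and ν be information structures (Borel probability measures on X × Y whose marginal on X equals ζ) such that ν is a garbling of μ. Then for every standard Borel action space U and every bounded jointly measurable cost function c : X × U → ℝ, the optimal values satisfy inf_γ J(μ, γ) ≤ inf_γ J(ν, γ), where both infima range over all Markov kernels γ from Y to U; that is, μ is more informative than ν. -/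
open MeasureTheory ProbabilityTheory

/-- A measure on `X × Y` given on rectangles by garbling the second coordinate of `μ` through `κ`
is the image of `μ` composed with `κ`. -/
lemma eq_map_compProd_of_garbling {X Y Z : Type*} [MeasurableSpace X] [MeasurableSpace Y]
    [MeasurableSpace Z] (μ : Measure (X × Y)) (ν : Measure (X × Z)) [IsFiniteMeasure μ]
    [IsFiniteMeasure ν] (κ : Kernel Y Z) [IsMarkovKernel κ]
    (h : ∀ A : Set X, ∀ B : Set Z, MeasurableSet A → MeasurableSet B →
      ν (A ×ˢ B) = ∫⁻ p in A ×ˢ (Set.univ : Set Y), κ p.2 B ∂μ) :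
    ν = (μ ⊗ₘ κ.comap Prod.snd measurable_snd).map fun q => (q.1.1, q.2) := by
  refine Measure.ext_prod fun {A B} hA hB => ?_
  have hpre : (fun q : (X × Y) × Z => (q.1.1, q.2)) ⁻¹' (A ×ˢ B) =
      (A ×ˢ (Set.univ : Set Y)) ×ˢ B := by
    ext q
    simp
  rw [h A B hA hB, Measure.map_apply (by fun_prop) (hA.prod hB), hpre,
    Measure.compProd_apply_prod (hA.prod .univ) hB]
  simp [Kernel.comap_apply]

/-- Precomposing a policy with the garbling kernel reproduces its expected cost. -/
lemma integral_comp_garbling {X Y Z U : Type*} [MeasurableSpace X] [MeasurableSpace Y]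
    [MeasurableSpace Z] [MeasurableSpace U] (μ : Measure (X × Y)) (ν : Measure (X × Z))
    [IsFiniteMeasure μ] [IsFiniteMeasure ν] (κ : Kernel Y Z) [IsMarkovKernel κ]
    (h : ∀ A : Set X, ∀ B : Set Z, MeasurableSet A → MeasurableSet B →
      ν (A ×ˢ B) = ∫⁻ p in A ×ˢ (Set.univ : Set Y), κ p.2 B ∂μ)
    (γ : Kernel Z U) [IsMarkovKernel γ] (c : X → U → ℝ) {M : ℝ} (hM : ∀ x u, |c x u| ≤ M)
    (hc : Measurable fun p : X × U => c p.1 p.2) :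
    ∫ p, ∫ u, c p.1 u ∂((γ ∘ₖ κ) p.2) ∂μ = ∫ p, ∫ u, c p.1 u ∂(γ p.2) ∂ν := by
  have hF : StronglyMeasurable fun p : X × Z => ∫ u, c p.1 u ∂(γ p.2) := by
    have hc' : StronglyMeasurable fun q : (X × Z) × U => c q.1.1 q.2 :=
      (hc.comp (by fun_prop : Measurable fun q : (X × Z) × U => (q.1.1, q.2))).stronglyMeasurable
    exact hc'.integral_kernel_prod_right' (κ := γ.comap Prod.snd measurable_snd)
  have hFM : ∀ p : X × Z, ‖∫ u, c p.1 u ∂(γ p.2)‖ ≤ M := fun p => by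
    simpa using norm_integral_le_of_norm_le_const (μ := γ p.2) (f := c p.1) (C := M)
      (.of_forall fun u => hM p.1 u)
  have hproj : Measurable fun q : (X × Y) × Z => (q.1.1, q.2) := by fun_prop
  rw [eq_map_compProd_of_garbling μ ν κ h,
    integral_map hproj.aemeasurable hF.aestronglyMeasurable, Measure.integral_compProd]
  · refine integral_congr_ae (.of_forall fun p => ?_)
    have hcp : Measurable (c p.1) := hc.comp measurable_prodMk_left
    exact Kernel.integral_comp (.of_bound hcp.aestronglyMeasurable M (.of_forall fun u => hM p.1 u))
  · exact .of_bound (hF.comp_measurable hproj).aestronglyMeasurable M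
      (.of_forall fun q => hFM (q.1.1, q.2))

/-- Forward direction of Blackwell's ordering in the standard Borel setup.
If the information structure `ν` is a garbling of `μ` (both having `X`-marginal `ζ`),
then for every standard Borel action space `U` and every bounded jointly measurable cost,
the optimal value under `μ` is at most the optimal value under `ν`. -/
theorem blackwell_garbling_implies_more_informative
    {X Y : Type*} [MeasurableSpace X] [StandardBorelSpace X]
    [MeasurableSpace Y] [StandardBorelSpace Y]
    (ζ : Measure X) [IsProbabilityMeasure ζ]
    (μ ν : Measure (X × Y)) [IsProbabilityMeasure μ] [IsProbabilityMeasure ν]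
    (hμ : μ.map Prod.fst = ζ) (hν : ν.map Prod.fst = ζ)
    (hgarb : ∃ κ : Kernel Y Y, IsMarkovKernel κ ∧
      ∀ A : Set X, ∀ B : Set Y, MeasurableSet A → MeasurableSet B →
        ν (A ×ˢ B) = ∫⁻ p in A ×ˢ (Set.univ : Set Y), κ p.2 B ∂μ)
    (U : Type*) [MeasurableSpace U] [StandardBorelSpace U]
    (c : X → U → ℝ)
    (hbdd : ∃ M : ℝ, ∀ x u, |c x u| ≤ M)
    (hmeas : Measurable fun p : X × U => c p.1 p.2) :
    (⨅ γ : {κ : Kernel Y U // IsMarkovKernel κ}, ∫ p, ∫ u, c p.1 u ∂(γ.1 p.2) ∂μ) ≤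
      ⨅ γ : {κ : Kernel Y U // IsMarkovKernel κ}, ∫ p, ∫ u, c p.1 u ∂(γ.1 p.2) ∂ν := by
  obtain ⟨κ, hκ, h⟩ := hgarb
  obtain ⟨M, hM⟩ := hbdd
  cases isEmpty_or_nonempty {κ : Kernel Y U // IsMarkovKernel κ} with
  | inl _ => simp [Real.iInf_of_isEmpty]
  | inr _ =>
    refine le_ciInf fun ⟨γ, hγ⟩ => ?_
    rw [← integral_comp_garbling μ ν κ h γ c hM hmeas]
    refine ciInf_le (f := fun γ : {κ : Kernel Y U // IsMarkovKernel κ} =>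
      ∫ p, ∫ u, c p.1 u ∂(γ.1 p.2) ∂μ) ⟨-M, ?_⟩ ⟨γ ∘ₖ κ, inferInstance⟩
    rintro _ ⟨⟨η, hη⟩, rfl⟩
    have hin : ∀ p : X × Y, ‖∫ u, c p.1 u ∂(η p.2)‖ ≤ M := fun p => by
      simpa using norm_integral_le_of_norm_le_const (μ := η p.2) (f := c p.1) (C := M)
        (.of_forall fun u => hM p.1 u)
    have hout : |∫ p, ∫ u, c p.1 u ∂(η p.2) ∂μ| ≤ M := by
      simpa using norm_integral_le_of_norm_le_const (μ := μ) (.of_forall hin)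
    exact (abs_le.mp hout).1
end

section
/- Let X, Y¹, Y² be nonempty finite sets and ζ a probability distribution on X. For two information structures μ and ν (probability distributions on X × Y¹ × Y² whose marginal on X equals ζ), the following are equivalent: (a) μ is better for the maximizer than ν over all finite games, i.e., for every pair of nonempty finite action sets U¹, U² and every cost function c : X × U¹ × U² → ℝ, V*(μ) ≥ V*(ν), where V*(P) := min over randomized policies γ¹ : Y¹ → P(U¹) of max over randomized policies γ² : Y² → P(U²) of Σ_{x,y¹,y²} P(x,y¹,y²) Σ_{u¹,u²} γ¹(y¹)(u¹) γ²(y²)(u²) c(x,u¹,u²); (b) there exist stochastic kernels κ¹ from Y¹ to Y¹ and κ² from Y² to Y² such that κ¹ν = κ²μ as distributions on X × Y¹ × Y². -/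
open Finset

/-- The randomized policies (equivalently, stochastic kernels) from `Y` to `U`. -/
def policies (Y U : Type) [Fintype U] : Set (Y → U → ℝ) :=
  {g | (∀ y u, 0 ≤ g y u) ∧ ∀ y, ∑ u, g y u = 1}

/-- The expected cost of a pair of policies under the information structure `P`. -/
def expectedCost {X Y₁ Y₂ U₁ U₂ : Type} [Fintype X] [Fintype Y₁] [Fintype Y₂] [Fintype U₁]
    [Fintype U₂] (P : X → Y₁ → Y₂ → ℝ) (c : X → U₁ → U₂ → ℝ) (g₁ : Y₁ → U₁ → ℝ)
    (g₂ : Y₂ → U₂ → ℝ) : ℝ :=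
  ∑ x, ∑ y₁, ∑ y₂, P x y₁ y₂ * ∑ u₁, ∑ u₂, g₁ y₁ u₁ * g₂ y₂ u₂ * c x u₁ u₂

/-- The composition of a kernel with a policy. -/
def kernelComp {Y Z U : Type} [Fintype Z] (κ : Y → Z → ℝ) (g : Z → U → ℝ) : Y → U → ℝ :=
  fun y u ↦ ∑ z, κ y z * g z u

section policies

variable {Y Z U : Type} [Fintype Z] [Fintype U]

theorem policies_eq_pi : policies Y U = Set.univ.pi fun _ ↦ stdSimplex ℝ U := by
  ext g
  simp [policies, stdSimplex, forall_and]

theorem isCompact_policies : IsCompact (policies Y U) := by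
  rw [policies_eq_pi]
  exact isCompact_univ_pi fun _ ↦ isCompact_stdSimplex ℝ U

theorem convex_policies : Convex ℝ (policies Y U) := by
  rw [policies_eq_pi]
  exact convex_pi fun _ _ ↦ convex_stdSimplex ℝ U

instance : CompactSpace (policies Y U) := isCompact_iff_compactSpace.mp isCompact_policies

theorem single_mem_policies [DecidableEq U] (f : Y → U) :
    (fun y ↦ Pi.single (f y) 1) ∈ policies Y U := by
  rw [policies_eq_pi]
  exact fun y _ ↦ single_mem_stdSimplex ℝ (f y)

instance [Nonempty U] : Nonempty (policies Y U) := by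
  classical
  exact ⟨_, single_mem_policies fun _ ↦ Classical.arbitrary U⟩

theorem kernelComp_mem_policies {κ : Y → Z → ℝ} {g : Z → U → ℝ} (hκ : κ ∈ policies Y Z)
    (hg : g ∈ policies Z U) : kernelComp κ g ∈ policies Y U := by
  refine ⟨fun y u ↦ sum_nonneg fun z _ ↦ mul_nonneg (hκ.1 y z) (hg.1 z u), fun y ↦ ?_⟩
  simp only [kernelComp]
  rw [sum_comm]
  simp [← mul_sum, hg.2, hκ.2]

end policies

section expectedCost

variable {X Y₁ Y₂ U₁ U₂ : Type} [Fintype X] [Fintype Y₁] [Fintype Y₂] [Fintype U₁] [Fintype U₂]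
  (P : X → Y₁ → Y₂ → ℝ) (c : X → U₁ → U₂ → ℝ)

theorem expectedCost_kernelComp_left (κ : Y₁ → Y₁ → ℝ) (g₁ : Y₁ → U₁ → ℝ) (g₂ : Y₂ → U₂ → ℝ) :
    expectedCost P c (kernelComp κ g₁) g₂ =
      expectedCost (fun x y₁ y₂ ↦ ∑ b, P x b y₂ * κ b y₁) c g₁ g₂ := by
  have h (x : X) (b : Y₁) (y₂ : Y₂) :
      ∑ u₁, ∑ u₂, (∑ z, κ b z * g₁ z u₁) * g₂ y₂ u₂ * c x u₁ u₂ =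
        ∑ z, κ b z * ∑ u₁, ∑ u₂, g₁ z u₁ * g₂ y₂ u₂ * c x u₁ u₂ := by
    simp only [sum_mul, mul_sum, mul_assoc]
    rw [sum_comm (s := (univ : Finset Y₁))]
    exact sum_congr rfl fun u₁ _ ↦ sum_comm
  simp only [expectedCost, kernelComp, h]
  refine sum_congr rfl fun x _ ↦ ?_
  rw [sum_comm, sum_comm (s := (univ : Finset Y₁))]
  refine sum_congr rfl fun y₂ _ ↦ ?_
  simp only [mul_sum (s := (univ : Finset Y₁)), sum_mul (s := (univ : Finset Y₁)), ← mul_assoc]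
  exact sum_comm

theorem expectedCost_kernelComp_right (κ : Y₂ → Y₂ → ℝ) (g₁ : Y₁ → U₁ → ℝ)
    (g₂ : Y₂ → U₂ → ℝ) :
    expectedCost P c g₁ (kernelComp κ g₂) =
      expectedCost (fun x y₁ y₂ ↦ ∑ b, P x y₁ b * κ b y₂) c g₁ g₂ := by
  have h (x : X) (y₁ : Y₁) (b : Y₂) :
      ∑ u₁, ∑ u₂, g₁ y₁ u₁ * (∑ z, κ b z * g₂ z u₂) * c x u₁ u₂ =
        ∑ z, κ b z * ∑ u₁, ∑ u₂, g₁ y₁ u₁ * g₂ z u₂ * c x u₁ u₂ := by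
    simp only [sum_mul, mul_sum, mul_assoc, mul_left_comm (κ b _)]
    rw [sum_comm (s := (univ : Finset Y₂))]
    exact sum_congr rfl fun u₁ _ ↦ sum_comm
  simp only [expectedCost, kernelComp, h]
  refine sum_congr rfl fun x _ ↦ sum_congr rfl fun y₁ _ ↦ ?_
  simp only [mul_sum (s := (univ : Finset Y₂)), sum_mul (s := (univ : Finset Y₂)), ← mul_assoc]
  exact sum_comm

theorem bddAbove_range_expectedCost (g₁ : Y₁ → U₁ → ℝ) :
    BddAbove (Set.range fun g₂ : policies Y₂ U₂ ↦ expectedCost P c g₁ g₂.1) := by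
  have h : Continuous fun g : Y₂ → U₂ → ℝ ↦ expectedCost P c g₁ g := by
    unfold expectedCost
    fun_prop
  exact (isCompact_range (h.comp continuous_subtype_val)).bddAbove

theorem bddBelow_range_expectedCost (g₂ : Y₂ → U₂ → ℝ) :
    BddBelow (Set.range fun g₁ : policies Y₁ U₁ ↦ expectedCost P c g₁.1 g₂) := by
  have h : Continuous fun g : Y₁ → U₁ → ℝ ↦ expectedCost P c g g₂ := by
    unfold expectedCost
    fun_prop
  exact (isCompact_range (h.comp continuous_subtype_val)).bddBelow

theorem bddBelow_range_iSup_expectedCost [Nonempty U₂] :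
    BddBelow (Set.range fun g₁ : policies Y₁ U₁ ↦
      ⨆ g₂ : policies Y₂ U₂, expectedCost P c g₁.1 g₂.1) := by
  let g₂ : policies Y₂ U₂ := Classical.arbitrary _
  obtain ⟨m, hm⟩ := bddBelow_range_expectedCost (U₁ := U₁) P c g₂.1
  refine ⟨m, ?_⟩
  rintro _ ⟨g₁, rfl⟩
  exact (hm ⟨g₁, rfl⟩).trans (le_ciSup (bddAbove_range_expectedCost P c g₁.1) g₂)

end expectedCost

section garbling

variable {X Y₁ Y₂ : Type} [Fintype X] [Fintype Y₁] [Fintype Y₂]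

theorem expectedCost_single_single [DecidableEq Y₁] [DecidableEq Y₂] (P c : X → Y₁ → Y₂ → ℝ) :
    expectedCost P c (fun y ↦ Pi.single y 1) (fun y ↦ Pi.single y 1) =
      ∑ x, ∑ y₁, ∑ y₂, P x y₁ y₂ * c x y₁ y₂ := by
  simp [expectedCost, Pi.single_apply]

theorem kernelComp_single {Y Z : Type} [Fintype Z] [DecidableEq Z] (κ : Y → Z → ℝ) :
    kernelComp κ (fun z ↦ Pi.single z 1) = κ := by
  ext y u
  simp [kernelComp, Pi.single_apply]

/-- Two disjoint sets of garblings are strictly separated by a cost function. -/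
theorem exists_separating_cost (μ ν : X → Y₁ → Y₂ → ℝ)
    (h : ¬ ∃ κ₁ ∈ policies Y₁ Y₁, ∃ κ₂ ∈ policies Y₂ Y₂,
      ∀ x y₁ y₂, (∑ b, ν x b y₂ * κ₁ b y₁) = ∑ b, μ x y₁ b * κ₂ b y₂) :
    ∃ (c : X → Y₁ → Y₂ → ℝ) (u v : ℝ), u < v ∧
      (∀ κ ∈ policies Y₂ Y₂, ∑ x, ∑ y₁, ∑ y₂, (∑ b, μ x y₁ b * κ b y₂) * c x y₁ y₂ ≤ u) ∧
      ∀ κ ∈ policies Y₁ Y₁, v ≤ ∑ x, ∑ y₁, ∑ y₂, (∑ b, ν x b y₂ * κ b y₁) * c x y₁ y₂ := by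
  classical
  let M : (Y₂ → Y₂ → ℝ) → X × Y₁ × Y₂ → ℝ := fun κ p ↦ ∑ b, μ p.1 p.2.1 b * κ b p.2.2
  let N : (Y₁ → Y₁ → ℝ) → X × Y₁ × Y₂ → ℝ := fun κ p ↦ ∑ b, ν p.1 b p.2.2 * κ b p.2.1
  have hM : IsLinearMap ℝ M :=
    ⟨fun κ κ' ↦ by ext; simp [M, mul_add, sum_add_distrib],
      fun a κ ↦ by ext; simp [M, mul_sum, mul_left_comm]⟩
  have hN : IsLinearMap ℝ N :=
    ⟨fun κ κ' ↦ by ext; simp [N, mul_add, sum_add_distrib],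
      fun a κ ↦ by ext; simp [N, mul_sum, mul_left_comm]⟩
  have hMc : Continuous M := by fun_prop
  have hNc : Continuous N := by fun_prop
  have hdisj : Disjoint (M '' policies Y₂ Y₂) (N '' policies Y₁ Y₁) := by
    rw [Set.disjoint_left]
    rintro _ ⟨κ₂, h₂, rfl⟩ ⟨κ₁, h₁, he⟩
    exact h ⟨κ₁, h₁, κ₂, h₂, fun x y₁ y₂ ↦ congrFun he (x, y₁, y₂)⟩
  obtain ⟨f, u, v, hu, huv, hv⟩ := geometric_hahn_banach_compact_closed
    (convex_policies.is_linear_image hM) (isCompact_policies.image hMc)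
    (convex_policies.is_linear_image hN) (isCompact_policies.image hNc).isClosed hdisj
  have hf (q : X × Y₁ × Y₂ → ℝ) : f q =
      ∑ x, ∑ y₁, ∑ y₂, q (x, y₁, y₂) * f (fun j ↦ if (x, y₁, y₂) = j then 1 else 0) := by
    rw [← ContinuousLinearMap.coe_coe, LinearMap.pi_apply_eq_sum_univ f.toLinearMap q]
    simp [Fintype.sum_prod_type]
  refine ⟨fun x y₁ y₂ ↦ f (fun j ↦ if (x, y₁, y₂) = j then 1 else 0), u, v, huv,
    fun κ hκ ↦ ?_, fun κ hκ ↦ ?_⟩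
  · exact (hf (M κ)).symm.trans_le (hu _ ⟨κ, hκ, rfl⟩).le
  · exact (hv _ ⟨κ, hκ, rfl⟩).le.trans_eq (hf (N κ))

end garbling

/-- Pęski's characterization for finite zero-sum Bayesian games.
`μ` is better for the maximizer than `ν` over all finite games iff there exist
stochastic kernels `κ¹` (garbling the minimizer's measurement of `ν`) and `κ²`
(garbling the maximizer's measurement of `μ`) such that `κ¹ν = κ²μ`. -/
theorem peski_finite
    {X Y₁ Y₂ : Type} [Fintype X] [Nonempty X] [Fintype Y₁] [Nonempty Y₁]
    [Fintype Y₂] [Nonempty Y₂]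
    (ζ : X → ℝ) (hζ0 : ∀ x, 0 ≤ ζ x) (hζ1 : ∑ x, ζ x = 1)
    (μ ν : X → Y₁ → Y₂ → ℝ)
    (hμ0 : ∀ x y₁ y₂, 0 ≤ μ x y₁ y₂) (hμ1 : ∑ x, ∑ y₁, ∑ y₂, μ x y₁ y₂ = 1)
    (hμζ : ∀ x, ∑ y₁, ∑ y₂, μ x y₁ y₂ = ζ x)
    (hν0 : ∀ x y₁ y₂, 0 ≤ ν x y₁ y₂) (hν1 : ∑ x, ∑ y₁, ∑ y₂, ν x y₁ y₂ = 1)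
    (hνζ : ∀ x, ∑ y₁, ∑ y₂, ν x y₁ y₂ = ζ x) :
    (∀ (U₁ U₂ : Type) [Fintype U₁] [Nonempty U₁] [Fintype U₂] [Nonempty U₂],
      ∀ c : X → U₁ → U₂ → ℝ,
      (⨅ γ₁ : {g : Y₁ → U₁ → ℝ // (∀ y u, 0 ≤ g y u) ∧ ∀ y, ∑ u, g y u = 1},
        ⨆ γ₂ : {g : Y₂ → U₂ → ℝ // (∀ y u, 0 ≤ g y u) ∧ ∀ y, ∑ u, g y u = 1},
          ∑ x, ∑ y₁, ∑ y₂, ν x y₁ y₂ *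
            ∑ u₁, ∑ u₂, γ₁.1 y₁ u₁ * γ₂.1 y₂ u₂ * c x u₁ u₂) ≤
      (⨅ γ₁ : {g : Y₁ → U₁ → ℝ // (∀ y u, 0 ≤ g y u) ∧ ∀ y, ∑ u, g y u = 1},
        ⨆ γ₂ : {g : Y₂ → U₂ → ℝ // (∀ y u, 0 ≤ g y u) ∧ ∀ y, ∑ u, g y u = 1},
          ∑ x, ∑ y₁, ∑ y₂, μ x y₁ y₂ *
            ∑ u₁, ∑ u₂, γ₁.1 y₁ u₁ * γ₂.1 y₂ u₂ * c x u₁ u₂))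
    ↔
    (∃ (κ₁ : Y₁ → Y₁ → ℝ) (κ₂ : Y₂ → Y₂ → ℝ),
      (∀ y y', 0 ≤ κ₁ y y') ∧ (∀ y, ∑ y', κ₁ y y' = 1) ∧
      (∀ y y', 0 ≤ κ₂ y y') ∧ (∀ y, ∑ y', κ₂ y y' = 1) ∧
      ∀ x y₁ y₂, (∑ b, ν x b y₂ * κ₁ b y₁) = ∑ b, μ x y₁ b * κ₂ b y₂) := by
  change (∀ (U₁ U₂ : Type) [Fintype U₁] [Nonempty U₁] [Fintype U₂] [Nonempty U₂],
      ∀ c : X → U₁ → U₂ → ℝ,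
      (⨅ γ₁ : policies Y₁ U₁, ⨆ γ₂ : policies Y₂ U₂, expectedCost ν c γ₁.1 γ₂.1) ≤
        ⨅ γ₁ : policies Y₁ U₁, ⨆ γ₂ : policies Y₂ U₂, expectedCost μ c γ₁.1 γ₂.1) ↔ _
  constructor
  · intro h
    classical
    by_contra hne
    obtain ⟨c, u, v, huv, hu, hv⟩ := exists_separating_cost μ ν fun ⟨κ₁, h₁, κ₂, h₂, he⟩ ↦
      hne ⟨κ₁, κ₂, h₁.1, h₁.2, h₂.1, h₂.2, he⟩
    refine huv.not_ge (le_trans ?_ ((h Y₁ Y₂ c).trans ?_))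
    · refine le_ciInf fun γ₁ ↦ le_ciSup_of_le (bddAbove_range_expectedCost ν c γ₁.1)
        ⟨_, single_mem_policies id⟩ ?_
      change v ≤ expectedCost ν c γ₁.1 fun y ↦ Pi.single y 1
      rw [← kernelComp_single γ₁.1, expectedCost_kernelComp_left, expectedCost_single_single]
      exact hv _ γ₁.2
    · refine ciInf_le_of_le (bddBelow_range_iSup_expectedCost μ c)
        ⟨_, single_mem_policies id⟩ (ciSup_le fun γ₂ ↦ ?_)
      change expectedCost μ c (fun y ↦ Pi.single y 1) γ₂.1 ≤ u
      rw [← kernelComp_single γ₂.1, expectedCost_kernelComp_right, expectedCost_single_single]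
      exact hu _ γ₂.2
  · rintro ⟨κ₁, κ₂, h₁, h₁', h₂, h₂', he⟩ U₁ U₂ _ _ _ _ c
    refine le_ciInf fun γ₁ ↦ ciInf_le_of_le (bddBelow_range_iSup_expectedCost ν c)
      ⟨_, kernelComp_mem_policies ⟨h₁, h₁'⟩ γ₁.2⟩ (ciSup_le fun γ₂ ↦ ?_)
    refine le_ciSup_of_le (bddAbove_range_expectedCost μ c γ₁.1)
      ⟨_, kernelComp_mem_policies ⟨h₂, h₂'⟩ γ₂.2⟩ (le_of_eq ?_)
    change expectedCost ν c (kernelComp κ₁ γ₁.1) γ₂.1 = expectedCost μ c γ₁.1 (kernelComp κ₂ γ₂.1)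
    rw [expectedCost_kernelComp_left, expectedCost_kernelComp_right]
    simp only [he]
end

section
/- Let X, Y¹, Y² be standard Borel spaces, ζ a Borel probability measure on X, and P an information structure on X × Y¹ × Y² satisfying Assumption 2.1. Let U¹ and U² be nonempty compact metric spaces (with their Borel σ-algebras) and let c : X × U¹ × U² → ℝ be a bounded jointly measurable cost function such that (u¹,u²) ↦ c(x,u¹,u²) is continuous for every x ∈ X. Then a saddle-point equilibrium exists in randomized policies: there are Markov kernels γ¹* from Y¹ to U¹ and γ²* from Y² to U² such that J_P(γ¹*, γ²) ≤ J_P(γ¹*, γ²*) ≤ J_P(γ¹, γ²*) for all Markov kernels γ¹ from Y¹ to U¹ and γ² from Y² to U²; consequently inf_{γ¹} sup_{γ²} J_P(γ¹,γ²) = sup_{γ²} inf_{γ¹} J_P(γ¹,γ²), so the zero-sum game has a value. -/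
open MeasureTheory ProbabilityTheory
open Set Filter Topology
open scoped BoundedContinuousFunction

theorem exists_saddle_of_isCompact_of_convex {A B : Type*} [Nonempty A] [Nonempty B]
    (J : A → B → ℝ)
    (hAc : IsCompact (range J)) (hAv : Convex ℝ (range J))
    (hBc : IsCompact (range fun b a => J a b)) (hBv : Convex ℝ (range fun b a => J a b)) :
    ∃ a b, (∀ b', J a b' ≤ J a b) ∧ ∀ a', J a b ≤ J a' b := by
  choose! φ hφ using fun y : A → ℝ => fun hy : y ∈ range (fun b a => J a b) => hy
  have key : ∀ a, ∀ y ∈ range (fun b a => J a b), J a (φ y) = y a :=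
    fun a y hy => congrFun (hφ y hy) a
  obtain ⟨_, ⟨a, rfl⟩, _, ⟨b, rfl⟩, hab⟩ :=
    Sion.exists_isSaddlePointOn (X := range J) (Y := range fun b a => J a b)
      (f := fun x y => x (φ y)) (range_nonempty J) hAv hAc
      (fun y _ => (continuous_apply (φ y)).continuousOn.lowerSemicontinuousOn)
      (fun y _ => ((LinearMap.proj (R := ℝ) (φ := fun _ : B => ℝ) (φ y)).convexOn hAv).quasiconvexOn)
      hBv (range_nonempty _) hBc
      (by
        rintro _ ⟨a, rfl⟩
        refine ContinuousOn.upperSemicontinuousOn ?_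
        exact (continuous_apply a).continuousOn.congr (key a))
      (by
        rintro _ ⟨a, rfl⟩
        refine ConcaveOn.quasiconcaveOn ?_
        exact ((LinearMap.proj (R := ℝ) (φ := fun _ : A => ℝ) a).concaveOn hBv).congr
          fun y hy => (key a y hy).symm)
  refine ⟨a, b, fun b' => ?_, fun a' => ?_⟩
  · simpa only [key _ _ (mem_range_self _)] using hab (J a) ⟨a, rfl⟩ _ ⟨b', rfl⟩
  · simpa only [key _ _ (mem_range_self _)] using hab (J a') ⟨a', rfl⟩ _ ⟨b, rfl⟩

theorem stronglyMeasurable_continuousMap {Y U : Type*} [MeasurableSpace Y] [MetricSpace U]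
    [CompactSpace U] (G : Y → C(U, ℝ)) (hG : ∀ u, Measurable fun y => G y u) :
    StronglyMeasurable G := by
  borelize C(U, ℝ)
  refine Measurable.stronglyMeasurable (measurable_of_isOpen fun O hO => ?_)
  obtain ⟨D, hDc, hDd⟩ := TopologicalSpace.exists_countable_dense U
  obtain ⟨S, hSc, hSd⟩ := TopologicalSpace.exists_countable_dense C(U, ℝ)
  have hball : ∀ (f : C(U, ℝ)) (n : ℕ),
      MeasurableSet (G ⁻¹' Metric.closedBall f (1 / ((n : ℝ) + 1))) := by
    intro f n
    have : G ⁻¹' Metric.closedBall f (1 / ((n : ℝ) + 1))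
        = ⋂ u ∈ D, {y | dist (G y u) (f u) ≤ 1 / ((n : ℝ) + 1)} := by
      ext y
      simp only [mem_preimage, Metric.mem_closedBall, mem_iInter]
      rw [ContinuousMap.dist_le (by positivity)]
      refine ⟨fun h u _ => h u, fun h u => ?_⟩
      have hcl : IsClosed {u | dist (G y u) (f u) ≤ 1 / ((n : ℝ) + 1)} :=
        isClosed_le (by fun_prop) continuous_const
      exact hcl.closure_subset_iff.2 (fun u hu => h u hu) (hDd u)
    rw [this]
    exact .biInter hDc fun u _ => measurableSet_le ((hG u).dist measurable_const) measurable_const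
  have hO' : O = ⋃ f ∈ S, ⋃ n ∈ {n : ℕ | Metric.closedBall f (1 / ((n : ℝ) + 1)) ⊆ O},
      Metric.closedBall f (1 / ((n : ℝ) + 1)) := by
    refine Subset.antisymm (fun g hg => ?_) (by simp)
    obtain ⟨ε, hε, hεO⟩ := Metric.isOpen_iff.1 hO g hg
    obtain ⟨n, hn⟩ := exists_nat_one_div_lt (half_pos hε)
    obtain ⟨f, hf, hfS⟩ := Metric.dense_iff.1 hSd g (1 / ((n : ℝ) + 1)) (by positivity)
    simp only [mem_iUnion]
    refine ⟨f, hfS, n, fun h hh => hεO ?_, ?_⟩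
    · rw [Metric.mem_closedBall] at hh
      rw [Metric.mem_ball] at hf ⊢
      linarith [dist_triangle h f g]
    · rw [Metric.mem_ball'] at hf
      exact hf.le
  rw [hO', preimage_iUnion₂]
  refine .biUnion hSc fun f _ => ?_
  rw [preimage_iUnion₂]
  exact .biUnion (to_countable _) fun n _ => hball f n

theorem isCompact_setOf_fst_eq {Y U : Type*} [TopologicalSpace Y] [PolishSpace Y]
    [MeasurableSpace Y] [BorelSpace Y] [MetricSpace U] [CompactSpace U] [MeasurableSpace U]
    [BorelSpace U] (Q : ProbabilityMeasure Y) :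
    IsCompact {μ : ProbabilityMeasure (Y × U) | (μ : Measure (Y × U)).fst = Q} := by
  refine IsCompact.of_isClosed_subset (isCompact_closure_of_isTightMeasureSet ?_) ?_ subset_closure
  · refine IsTightMeasureSet.prodMk ?_ .of_compactSpace
    refine (isTightMeasureSet_singleton (μ := (Q : Measure Y))).subset ?_
    rintro _ ⟨_, ⟨μ, hμ, rfl⟩, rfl⟩
    exact hμ
  · have : {μ : ProbabilityMeasure (Y × U) | (μ : Measure (Y × U)).fst = Q} =
        {μ | μ.map (continuous_fst (X := Y) (Y := U)).measurable.aemeasurable = Q} := by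
      ext μ
      exact (Subtype.ext_iff (a1 := μ.map _) (a2 := Q)).symm
    rw [this]
    exact isClosed_eq (ProbabilityMeasure.continuous_map continuous_fst) continuous_const

theorem continuousOn_integral_caratheodory {Y U : Type*} [TopologicalSpace Y] [PolishSpace Y]
    [MeasurableSpace Y] [BorelSpace Y] [MetricSpace U] [CompactSpace U] [MeasurableSpace U]
    [BorelSpace U] (Q : ProbabilityMeasure Y) (g : Y → U → ℝ)
    (hgm : Measurable (Function.uncurry g)) (hgc : ∀ y, Continuous (g y))
    {M : ℝ} (hgb : ∀ y u, |g y u| ≤ M) :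
    ContinuousOn (fun μ : ProbabilityMeasure (Y × U) => ∫ p, g p.1 p.2 ∂(μ : Measure (Y × U)))
      {μ | (μ : Measure (Y × U)).fst = Q} := by
  let G : Y → C(U, ℝ) := fun y => ⟨g y, hgc y⟩
  have hGm : StronglyMeasurable G :=
    stronglyMeasurable_continuousMap G fun u => hgm.comp measurable_prodMk_right
  have hGi : Integrable G (Q : Measure Y) := by
    refine .of_bound hGm.aestronglyMeasurable (max M 0) (.of_forall fun y => ?_)
    rw [ContinuousMap.norm_le _ (le_max_right _ _)]
    exact fun u => (hgb y u).trans (le_max_left _ _)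
  refine continuousOn_of_uniform_approx_of_continuousOn fun V hV => ?_
  obtain ⟨ε, hε, hεV⟩ := Metric.mem_uniformity_dist.1 hV
  let : MetricSpace Y := TopologicalSpace.metrizableSpaceMetric Y
  obtain ⟨F, hF, hFi⟩ := hGi.exists_boundedContinuous_integral_sub_le (half_pos hε)
  let Φ : (Y × U) →ᵇ ℝ := .ofNormedAddCommGroup (fun p => F p.1 p.2)
    (by fun_prop) ‖F‖ (fun p => ((F p.1).norm_coe_le_norm p.2).trans (F.norm_coe_le_norm p.1))
  refine ⟨fun μ => ∫ p, Φ p ∂(μ : Measure (Y × U)),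
    (ProbabilityMeasure.continuous_integral_boundedContinuousFunction Φ).continuousOn,
    fun μ hμ => hεV ?_⟩
  have hgi : Integrable (fun p : Y × U => g p.1 p.2) (μ : Measure (Y × U)) :=
    .of_bound hgm.aestronglyMeasurable M (.of_forall fun p => hgb p.1 p.2)
  have hdi : Integrable (fun y => ‖G y - F y‖) (μ : Measure (Y × U)).fst := by
    rw [hμ]; exact (hGi.sub hFi).norm
  rw [dist_eq_norm, ← integral_sub hgi (Φ.integrable _)]
  calc _ ≤ ∫ p, ‖G p.1 - F p.1‖ ∂(μ : Measure (Y × U)) := by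
        refine norm_integral_le_of_norm_le (hdi.comp_measurable measurable_fst)
          (.of_forall fun p => ?_)
        exact (G p.1 - F p.1).norm_coe_le_norm p.2
    _ = ∫ y, ‖G y - F y‖ ∂(μ : Measure (Y × U)).fst :=
        (integral_map measurable_fst.aemeasurable hdi.aestronglyMeasurable).symm
    _ ≤ ε / 2 := by rw [hμ]; exact hF
    _ < ε := half_lt_self hε

theorem measurable_integral_kernel_param {Y Z U : Type*} [MeasurableSpace Y] [MeasurableSpace Z]
    [MeasurableSpace U] (η : Kernel Y Z) [IsSFiniteKernel η] (c : Z → U → ℝ)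
    (hc : Measurable (Function.uncurry c)) :
    Measurable (Function.uncurry fun y u => ∫ z, c z u ∂η y) := by
  have h : StronglyMeasurable fun q : (Y × U) × Z => c q.2 q.1.2 :=
    (hc.comp (by fun_prop : Measurable fun q : (Y × U) × Z => (q.2, q.1.2))).stronglyMeasurable
  exact (h.integral_kernel_prod_right' (κ := η.prodMkRight U)).measurable

theorem continuous_integral_param {Z U : Type*} [MeasurableSpace Z] [MetricSpace U]
    [MeasurableSpace U] [BorelSpace U] (ν : Measure Z) [IsFiniteMeasure ν] (c : Z → U → ℝ)
    (hc : Measurable (Function.uncurry c)) (hcc : ∀ z, Continuous (c z))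
    {M : ℝ} (hcb : ∀ z u, |c z u| ≤ M) :
    Continuous fun u => ∫ z, c z u ∂ν :=
  continuous_of_dominated (bound := fun _ => M)
    (fun u => (hc.comp (by fun_prop : Measurable fun z => (z, u))).aestronglyMeasurable)
    (fun u => .of_forall fun z => hcb z u) (integrable_const M) (.of_forall hcc)

theorem abs_integral_le_of_abs_le {Z : Type*} [MeasurableSpace Z] (ν : Measure Z)
    [IsProbabilityMeasure ν] {f : Z → ℝ} {M : ℝ} (hf : ∀ z, |f z| ≤ M) : |∫ z, f z ∂ν| ≤ M := by
  simpa using norm_integral_le_of_norm_le_const (μ := ν) (f := f) (.of_forall hf)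

theorem integral_policy_eq {Y Z U : Type*} [MeasurableSpace Y] [MeasurableSpace Z]
    [StandardBorelSpace Z] [Nonempty Z] [MeasurableSpace U]
    (ρ : Measure (Y × Z)) [IsProbabilityMeasure ρ] (κ : Kernel Y U) [IsMarkovKernel κ]
    (c : Z → U → ℝ) (hc : Measurable (Function.uncurry c)) {M : ℝ} (hcb : ∀ z u, |c z u| ≤ M) :
    ∫ p, ∫ u, c p.2 u ∂κ p.1 ∂ρ = ∫ q, ∫ z, c z q.2 ∂ρ.condKernel q.1 ∂(ρ.fst ⊗ₘ κ) := by
  have hm1 : Measurable fun p : Y × Z => ∫ u, c p.2 u ∂κ p.1 :=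
    measurable_integral_kernel_param κ (fun u z => c z u) (hc.comp measurable_swap)
  have hm2 : Measurable fun q : Y × U => ∫ z, c z q.2 ∂ρ.condKernel q.1 :=
    measurable_integral_kernel_param ρ.condKernel c hc
  conv_lhs => rw [← ρ.disintegrate ρ.condKernel]
  rw [Measure.integral_compProd, Measure.integral_compProd]
  · refine integral_congr_ae (.of_forall fun y => ?_)
    have hi : Integrable (Function.uncurry c) ((ρ.condKernel y).prod (κ y)) :=
      .of_bound hc.aestronglyMeasurable M (.of_forall fun p => hcb p.1 p.2)
    exact integral_integral_swap hi
  · exact .of_bound hm2.aestronglyMeasurable M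
      (.of_forall fun q => abs_integral_le_of_abs_le _ fun z => hcb z q.2)
  · exact .of_bound hm1.aestronglyMeasurable M
      (.of_forall fun p => abs_integral_le_of_abs_le _ fun u => hcb p.2 u)

theorem range_policy_eq_image {Y Z U ι : Type*} [MeasurableSpace Y]
    [MeasurableSpace Z] [StandardBorelSpace Z] [Nonempty Z] [Nonempty U]
    [MeasurableSpace U] [StandardBorelSpace U] (ρ : Measure (Y × Z)) [IsProbabilityMeasure ρ]
    (c : ι → Z → U → ℝ) (hc : ∀ i, Measurable (Function.uncurry (c i)))
    {M : ℝ} (hcb : ∀ i z u, |c i z u| ≤ M) :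
    (range fun (κ : {κ : Kernel Y U // IsMarkovKernel κ}) i =>
      ∫ p, ∫ u, c i p.2 u ∂κ.1 p.1 ∂ρ) =
    (fun (μ : ProbabilityMeasure (Y × U)) i =>
      ∫ q, ∫ z, c i z q.2 ∂ρ.condKernel q.1 ∂(μ : Measure (Y × U))) ''
      {μ | (μ : Measure (Y × U)).fst = ρ.fst} := by
  ext v
  constructor
  · rintro ⟨⟨κ, hκ⟩, rfl⟩
    exact ⟨⟨ρ.fst ⊗ₘ κ, inferInstance⟩, Measure.fst_compProd _ _,
      funext fun i => (integral_policy_eq ρ κ (c i) (hc i) (hcb i)).symm⟩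
  · rintro ⟨μ, hμ, rfl⟩
    refine ⟨⟨(μ : Measure (Y × U)).condKernel, inferInstance⟩, funext fun i => ?_⟩
    have hμ' : ρ.fst ⊗ₘ (μ : Measure (Y × U)).condKernel = μ := by
      rw [← hμ]; exact Measure.disintegrate _ _
    refine (integral_policy_eq ρ _ (c i) (hc i) (hcb i)).trans ?_
    rw [hμ']

theorem isCompact_range_policy {Y Z U ι : Type*} [MeasurableSpace Y] [StandardBorelSpace Y]
    [MeasurableSpace Z] [StandardBorelSpace Z] [Nonempty Z] [MetricSpace U] [CompactSpace U]
    [Nonempty U] [MeasurableSpace U] [BorelSpace U] (ρ : Measure (Y × Z)) [IsProbabilityMeasure ρ]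
    (c : ι → Z → U → ℝ) (hc : ∀ i, Measurable (Function.uncurry (c i)))
    (hcc : ∀ i z, Continuous (c i z)) {M : ℝ} (hcb : ∀ i z u, |c i z u| ≤ M) :
    IsCompact (range fun (κ : {κ : Kernel Y U // IsMarkovKernel κ}) i =>
      ∫ p, ∫ u, c i p.2 u ∂κ.1 p.1 ∂ρ) := by
  let := upgradeStandardBorel Y
  rw [range_policy_eq_image ρ c hc hcb]
  refine (isCompact_setOf_fst_eq ⟨ρ.fst, inferInstance⟩).image_of_continuousOn ?_
  refine continuousOn_pi.2 fun i => ?_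
  exact continuousOn_integral_caratheodory ⟨ρ.fst, inferInstance⟩
    (fun y u => ∫ z, c i z u ∂ρ.condKernel y) (measurable_integral_kernel_param _ _ (hc i))
    (fun y => continuous_integral_param _ _ (hc i) (hcc i) (hcb i))
    (fun y u => abs_integral_le_of_abs_le _ fun z => hcb i z u)

theorem convex_range_policy {Y Z U ι : Type*} [MeasurableSpace Y]
    [MeasurableSpace Z] [StandardBorelSpace Z] [Nonempty Z] [Nonempty U]
    [MeasurableSpace U] [StandardBorelSpace U] (ρ : Measure (Y × Z)) [IsProbabilityMeasure ρ]
    (c : ι → Z → U → ℝ) (hc : ∀ i, Measurable (Function.uncurry (c i)))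
    {M : ℝ} (hcb : ∀ i z u, |c i z u| ≤ M) :
    Convex ℝ (range fun (κ : {κ : Kernel Y U // IsMarkovKernel κ}) i =>
      ∫ p, ∫ u, c i p.2 u ∂κ.1 p.1 ∂ρ) := by
  rw [range_policy_eq_image ρ c hc hcb]
  rintro _ ⟨μ, hμ, rfl⟩ _ ⟨ν, hν, rfl⟩ a b ha hb hab
  have hab' : ENNReal.ofReal a + ENNReal.ofReal b = 1 := by
    rw [← ENNReal.ofReal_add ha hb, hab, ENNReal.ofReal_one]
  let τ : Measure (Y × U) := ENNReal.ofReal a • (μ : Measure (Y × U)) +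
    ENNReal.ofReal b • (ν : Measure (Y × U))
  have hτ : IsProbabilityMeasure τ := ⟨by simp [τ, hab']⟩
  refine ⟨⟨τ, hτ⟩, ?_, funext fun i => ?_⟩
  · change τ.fst = _
    change Measure.map Prod.fst _ = _ at hμ hν
    rw [Measure.fst, Measure.map_add _ _ measurable_fst, Measure.map_smul, Measure.map_smul, hμ, hν,
      ← add_smul, hab', one_smul]
  · have hi : ∀ μ : Measure (Y × U), IsProbabilityMeasure μ →
        Integrable (fun q : Y × U => ∫ z, c i z q.2 ∂ρ.condKernel q.1) μ := fun μ _ =>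
      .of_bound (measurable_integral_kernel_param _ _ (hc i)).aestronglyMeasurable M
        (.of_forall fun q => abs_integral_le_of_abs_le _ fun z => hcb i z q.2)
    change ∫ q, _ ∂τ = _
    rw [integral_add_measure ((hi _ inferInstance).smul_measure ENNReal.ofReal_ne_top)
      ((hi _ inferInstance).smul_measure ENNReal.ofReal_ne_top), integral_smul_measure,
      integral_smul_measure, ENNReal.toReal_ofReal ha, ENNReal.toReal_ofReal hb]
    rfl

theorem iInf_iSup_eq_iSup_iInf_of_saddle {A B : Type*} (J : A → B → ℝ) {M : ℝ}
    (hM : ∀ a b, |J a b| ≤ M) {a : A} {b : B} (hb : ∀ b', J a b' ≤ J a b)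
    (ha : ∀ a', J a b ≤ J a' b) : ⨅ a, ⨆ b, J a b = ⨆ b, ⨅ a, J a b := by
  have : Nonempty A := ⟨a⟩
  have : Nonempty B := ⟨b⟩
  have hab : ∀ a, BddAbove (range (J a)) :=
    fun a => ⟨M, by rintro _ ⟨b, rfl⟩; exact (abs_le.1 (hM a b)).2⟩
  have hbe : ∀ b, BddBelow (range fun a => J a b) :=
    fun b => ⟨-M, by rintro _ ⟨a, rfl⟩; exact (abs_le.1 (hM a b)).1⟩
  have h1 : ∀ a', J a b ≤ ⨆ b', J a' b' := fun a' => (ha a').trans (le_ciSup (hab a') b)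
  have h2 : ∀ b', ⨅ a', J a' b' ≤ J a b := fun b' => (ciInf_le (hbe b') a).trans (hb b')
  refine le_antisymm ?_ ((ciSup_le h2).trans (le_ciInf h1))
  calc ⨅ a, ⨆ b, J a b ≤ ⨆ b', J a b' :=
        ciInf_le ⟨J a b, by rintro _ ⟨a', rfl⟩; exact h1 a'⟩ a
    _ ≤ J a b := ciSup_le hb
    _ ≤ ⨅ a', J a' b := le_ciInf ha
    _ ≤ ⨆ b, ⨅ a, J a b :=
        le_ciSup (f := fun b => ⨅ a, J a b)
          ⟨J a b, by rintro _ ⟨b', rfl⟩; exact h2 b'⟩ b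



/-- Existence of a saddle-point equilibrium in randomized policies for a
zero-sum Bayesian game with standard Borel spaces, compact metric action spaces, a bounded
measurable cost continuous in the actions, and an information structure satisfying
Assumption 2.1 (absolute continuity with respect to a product reference measure).
Consequently the game has a value: inf-sup equals sup-inf. -/
theorem existence_of_equilibrium
    {X Y₁ Y₂ : Type*} [MeasurableSpace X] [StandardBorelSpace X]
    [MeasurableSpace Y₁] [StandardBorelSpace Y₁]
    [MeasurableSpace Y₂] [StandardBorelSpace Y₂]
    (ζ : Measure X) [IsProbabilityMeasure ζ]
    (P : Measure (X × Y₁ × Y₂)) [IsProbabilityMeasure P]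
    (hmarg : P.map Prod.fst = ζ)
    (hac : ∃ (Q₁ : Measure Y₁) (Q₂ : Measure Y₂), IsProbabilityMeasure Q₁ ∧
      IsProbabilityMeasure Q₂ ∧ P ≪ ζ.prod (Q₁.prod Q₂))
    {U₁ U₂ : Type*} [MetricSpace U₁] [CompactSpace U₁] [Nonempty U₁]
    [MeasurableSpace U₁] [BorelSpace U₁]
    [MetricSpace U₂] [CompactSpace U₂] [Nonempty U₂]
    [MeasurableSpace U₂] [BorelSpace U₂]
    (c : X → U₁ → U₂ → ℝ)
    (hbdd : ∃ M : ℝ, ∀ x u₁ u₂, |c x u₁ u₂| ≤ M)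
    (hmeas : Measurable fun p : X × U₁ × U₂ => c p.1 p.2.1 p.2.2)
    (hcont : ∀ x, Continuous fun q : U₁ × U₂ => c x q.1 q.2)
    (J : Kernel Y₁ U₁ → Kernel Y₂ U₂ → ℝ)
    (hJ : ∀ γ₁ γ₂, J γ₁ γ₂ =
      ∫ p : X × Y₁ × Y₂, ∫ u₁, ∫ u₂, c p.1 u₁ u₂ ∂(γ₂ p.2.2) ∂(γ₁ p.2.1) ∂P) :
    ∃ (γ₁s : Kernel Y₁ U₁) (γ₂s : Kernel Y₂ U₂),
      IsMarkovKernel γ₁s ∧ IsMarkovKernel γ₂s ∧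
      (∀ γ₂ : Kernel Y₂ U₂, IsMarkovKernel γ₂ → J γ₁s γ₂ ≤ J γ₁s γ₂s) ∧
      (∀ γ₁ : Kernel Y₁ U₁, IsMarkovKernel γ₁ → J γ₁s γ₂s ≤ J γ₁ γ₂s) ∧
      (⨅ γ₁ : {κ : Kernel Y₁ U₁ // IsMarkovKernel κ},
          ⨆ γ₂ : {κ : Kernel Y₂ U₂ // IsMarkovKernel κ}, J γ₁.1 γ₂.1) =
        (⨆ γ₂ : {κ : Kernel Y₂ U₂ // IsMarkovKernel κ},
          ⨅ γ₁ : {κ : Kernel Y₁ U₁ // IsMarkovKernel κ}, J γ₁.1 γ₂.1) := by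
  obtain ⟨M, hM⟩ := hbdd
  have hne : Nonempty (X × Y₁ × Y₂) := nonempty_of_isProbabilityMeasure P
  have : Nonempty (X × Y₂) := hne.map fun p => (p.1, p.2.2)
  have : Nonempty (X × Y₁) := hne.map fun p => (p.1, p.2.1)
  let A := {κ : Kernel Y₁ U₁ // IsMarkovKernel κ}
  let B := {κ : Kernel Y₂ U₂ // IsMarkovKernel κ}
  have : Nonempty A := ⟨⟨Kernel.const _ (Measure.dirac (Classical.arbitrary U₁)), inferInstance⟩⟩
  have : Nonempty B := ⟨⟨Kernel.const _ (Measure.dirac (Classical.arbitrary U₂)), inferInstance⟩⟩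
  have instA (κ : A) : IsMarkovKernel κ.1 := κ.2
  have instB (κ : B) : IsMarkovKernel κ.1 := κ.2
  have hp1 : Measurable fun p : X × Y₁ × Y₂ => (p.2.1, (p.1, p.2.2)) := by fun_prop
  have hp2 : Measurable fun p : X × Y₁ × Y₂ => (p.2.2, (p.1, p.2.1)) := by fun_prop
  let ρ₁ := P.map fun p => (p.2.1, (p.1, p.2.2))
  let ρ₂ := P.map fun p => (p.2.2, (p.1, p.2.1))
  have : IsProbabilityMeasure ρ₁ := Measure.isProbabilityMeasure_map hp1.aemeasurable
  have : IsProbabilityMeasure ρ₂ := Measure.isProbabilityMeasure_map hp2.aemeasurable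
  -- the cost seen by each player once the opponent's policy is fixed
  let c₁ : B → X × Y₂ → U₁ → ℝ := fun γ z u₁ => ∫ u₂, c z.1 u₁ u₂ ∂γ.1 z.2
  let c₂ : A → X × Y₁ → U₂ → ℝ := fun γ z u₂ => ∫ u₁, c z.1 u₁ u₂ ∂γ.1 z.2
  have hc₁b : ∀ γ z u, |c₁ γ z u| ≤ M := fun γ z u => abs_integral_le_of_abs_le _ (hM _ _)
  have hc₂b : ∀ γ z u, |c₂ γ z u| ≤ M := fun γ z u =>
    abs_integral_le_of_abs_le _ fun _ => hM _ _ _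
  have hc₁m : ∀ γ, Measurable (Function.uncurry (c₁ γ)) := fun γ =>
    (measurable_integral_kernel_param γ.1 (fun u₂ (q : X × U₁) => c q.1 q.2 u₂)
      (hmeas.comp (by fun_prop : Measurable fun r : U₂ × X × U₁ => (r.2.1, r.2.2, r.1)))).comp
      (by fun_prop : Measurable fun r : (X × Y₂) × U₁ => (r.1.2, (r.1.1, r.2)))
  have hc₂m : ∀ γ, Measurable (Function.uncurry (c₂ γ)) := fun γ =>
    (measurable_integral_kernel_param γ.1 (fun u₁ (q : X × U₂) => c q.1 u₁ q.2)
      (hmeas.comp (by fun_prop : Measurable fun r : U₁ × X × U₂ => (r.2.1, r.1, r.2.2)))).comp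
      (by fun_prop : Measurable fun r : (X × Y₁) × U₂ => (r.1.2, (r.1.1, r.2)))
  have hc₁c : ∀ γ z, Continuous (c₁ γ z) := fun γ z =>
    continuous_integral_param _ (fun u₂ u₁ => c z.1 u₁ u₂)
      (hmeas.comp (by fun_prop : Measurable fun r : U₂ × U₁ => (z.1, r.2, r.1)))
      (fun u₂ => (hcont z.1).comp (by fun_prop : Continuous fun u₁ => (u₁, u₂)))
      fun u₂ u₁ => hM _ _ _
  have hc₂c : ∀ γ z, Continuous (c₂ γ z) := fun γ z =>
    continuous_integral_param _ (fun u₁ u₂ => c z.1 u₁ u₂)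
      (hmeas.comp (by fun_prop : Measurable fun r : U₁ × U₂ => (z.1, r.1, r.2)))
      (fun u₁ => (hcont z.1).comp (by fun_prop : Continuous fun u₂ => (u₁, u₂)))
      fun u₁ u₂ => hM _ _ _
  have hJ₁ : (fun (γ₁ : A) (γ₂ : B) => J γ₁.1 γ₂.1) =
      fun γ₁ γ₂ => ∫ p, ∫ u, c₁ γ₂ p.2 u ∂γ₁.1 p.1 ∂ρ₁ := by
    funext γ₁ γ₂
    rw [hJ, integral_map hp1.aemeasurable]
    exact (measurable_integral_kernel_param γ₁.1 (fun u z => c₁ γ₂ z u)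
      ((hc₁m γ₂).comp measurable_swap)).aestronglyMeasurable
  have hJ₂ : (fun (γ₂ : B) (γ₁ : A) => J γ₁.1 γ₂.1) =
      fun γ₂ γ₁ => ∫ p, ∫ u, c₂ γ₁ p.2 u ∂γ₂.1 p.1 ∂ρ₂ := by
    funext γ₂ γ₁
    rw [hJ, integral_map hp2.aemeasurable]
    · refine integral_congr_ae (.of_forall fun p => ?_)
      exact integral_integral_swap (f := c p.1) (.of_bound (hmeas.comp
        (by fun_prop : Measurable fun r : U₁ × U₂ => (p.1, r.1, r.2))).aestronglyMeasurable M
        (.of_forall fun r => hM _ _ _))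
    · exact (measurable_integral_kernel_param γ₂.1 (fun u z => c₂ γ₁ z u)
        ((hc₂m γ₁).comp measurable_swap)).aestronglyMeasurable
  obtain ⟨γ₁, γ₂, h₂, h₁⟩ := exists_saddle_of_isCompact_of_convex
    (fun (γ₁ : A) (γ₂ : B) => J γ₁.1 γ₂.1)
    (by rw [hJ₁]; exact isCompact_range_policy ρ₁ c₁ hc₁m hc₁c hc₁b)
    (by rw [hJ₁]; exact convex_range_policy ρ₁ c₁ hc₁m hc₁b)
    (by rw [hJ₂]; exact isCompact_range_policy ρ₂ c₂ hc₂m hc₂c hc₂b)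
    (by rw [hJ₂]; exact convex_range_policy ρ₂ c₂ hc₂m hc₂b)
  refine ⟨γ₁.1, γ₂.1, γ₁.2, γ₂.2, fun γ h => h₂ ⟨γ, h⟩, fun γ h => h₁ ⟨γ, h⟩, ?_⟩
  refine iInf_iSup_eq_iSup_iInf_of_saddle (fun (γ₁ : A) (γ₂ : B) => J γ₁.1 γ₂.1) (M := M)
    (fun γ₁ γ₂ => ?_) h₂ h₁
  rw [hJ]
  exact abs_integral_le_of_abs_le _ fun p => abs_integral_le_of_abs_le _ fun u₁ =>
    abs_integral_le_of_abs_le _ fun u₂ => hM _ _ _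
end

section
/- Let X be a standard Borel space, Y a nonempty compact metric space, and ζ a Borel probability measure on X. Let μ and ν be information structures on X × Y (Borel probability measures with X-marginal ζ) such that μ ≪ ζ ⊗ Q̄_μ and ν ≪ ζ ⊗ Q̄_ν for some Borel probability measures Q̄_μ, Q̄_ν on Y. Suppose that μ is more informative than ν over all single-player decision problems with compact action spaces and costs continuous in the action: for every nonempty compact metric action space U (with its Borel σ-algebra) and every bounded jointly measurable c : X × U → ℝ such that u ↦ c(x,u) is continuous for every x, inf_γ J(μ, γ) ≤ inf_γ J(ν, γ), where the infima range over all Markov kernels γ from Y to U. Then ν is a garbling of μ: there exists a Markov kernel κ from Y to Y such that ν(A × B) = ∫_{A×Y} κ(y)(B) μ(dx,dy) for all Borel A ⊆ X and B ⊆ Y. -/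
open MeasureTheory ProbabilityTheory

/-- The measure `B ↦ μ (A × B)` on the second factor. -/
noncomputable def MeasureTheory.Measure.slice {X Y : Type*} [MeasurableSpace X]
    [MeasurableSpace Y] (μ : Measure (X × Y)) (A : Set X) : Measure Y :=
  (μ.restrict (A ×ˢ Set.univ)).snd

namespace MeasureTheory.Measure

section Slice

variable {X Y : Type*} [MeasurableSpace X] [MeasurableSpace Y] {μ : Measure (X × Y)}

instance [IsFiniteMeasure μ] (A : Set X) : IsFiniteMeasure (μ.slice A) := by
  unfold slice; infer_instance

lemma slice_apply (μ : Measure (X × Y)) (A : Set X) {B : Set Y} (hB : MeasurableSet B) :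
    μ.slice A B = μ (A ×ˢ B) := by
  rw [slice, snd_apply hB, restrict_apply (measurable_snd hB)]
  congr 1
  ext p
  simp [and_comm]

lemma slice_absolutelyContinuous (μ : Measure (X × Y)) (A : Set X) : μ.slice A ≪ μ.snd :=
  (absolutelyContinuous_of_le restrict_le_self).map measurable_snd

lemma lintegral_slice (μ : Measure (X × Y)) (A : Set X) {g : Y → ENNReal} (hg : Measurable g) :
    ∫⁻ y, g y ∂μ.slice A = ∫⁻ p in A ×ˢ Set.univ, g p.2 ∂μ :=
  lintegral_map hg measurable_snd

lemma integral_slice (μ : Measure (X × Y)) {A : Set X} (hA : MeasurableSet A) {g : Y → ℝ}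
    (hg : StronglyMeasurable g) :
    ∫ y, g y ∂μ.slice A = ∫ p, A.indicator 1 p.1 * g p.2 ∂μ := by
  rw [slice, snd, integral_map measurable_snd.aemeasurable hg.aestronglyMeasurable,
    ← integral_indicator (hA.prod MeasurableSet.univ)]
  refine integral_congr_ae (.of_forall fun p => ?_)
  by_cases h : p.1 ∈ A <;> simp [h]

end Slice

end MeasureTheory.Measure

/-- If no linear combination of the continuous functions `F i` on a compact space separates the
point `v` from the convex joint range of `F`, then `v` is attained. -/
lemma exists_forall_eq_of_not_separated {ι K : Type*} [TopologicalSpace K] [CompactSpace K]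
    (F : ι → K → ℝ) (hF : ∀ i, Continuous (F i))
    (hconv : ∀ P Q : K, ∀ a b : ℝ, 0 ≤ a → 0 ≤ b → a + b = 1 →
      ∃ R, ∀ i, F i R = a * F i P + b * F i Q)
    (v : ι → ℝ)
    (hsep : ∀ (s : Finset ι) (l : s → ℝ) (w : ℝ),
      (∀ P, w ≤ ∑ i, l i * F i P) → w ≤ ∑ i, l i * v i) :
    ∃ P, ∀ i, F i P = v i := by
  classical
  have key := isCompact_univ.inter_iInter_nonempty (fun i => {P : K | F i P = v i})
    (fun i => isClosed_eq (hF i) continuous_const) fun s => by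
      let G : K → s → ℝ := fun P i => F i P
      have hG : Continuous G := continuous_pi fun i => hF i
      have hcv : Convex ℝ (Set.range G) := by
        rintro _ ⟨P, rfl⟩ _ ⟨Q, rfl⟩ a b ha hb hab
        obtain ⟨R, hR⟩ := hconv P Q a b ha hb hab
        exact ⟨R, funext fun i => by simp [G, hR]⟩
      by_cases hmem : (fun i : s => v i) ∈ Set.range G
      · obtain ⟨P, hP⟩ := hmem
        refine ⟨P, Set.mem_univ _, ?_⟩
        simp only [Set.mem_iInter, Set.mem_ofPred_eq]
        exact fun i hi => congrFun hP ⟨i, hi⟩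
      · obtain ⟨f, u, hfv, hfu⟩ :=
          geometric_hahn_banach_point_closed hcv (isCompact_range hG).isClosed hmem
        have hf : ∀ x : s → ℝ, f x = ∑ i, f (fun j => if i = j then 1 else 0) * x i := fun x => by
          have := LinearMap.pi_apply_eq_sum_univ (f : (s → ℝ) →ₗ[ℝ] ℝ) x
          simpa [mul_comm] using this
        have := hsep s (fun i => f (fun j => if i = j then 1 else 0)) u fun P => by
          rw [← hf fun i : s => F i P]
          exact (hfu _ ⟨P, rfl⟩).le
        rw [← hf fun i : s => v i] at this
        exact absurd hfv this.not_gt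
  obtain ⟨P, -, hP⟩ := key
  exact ⟨P, fun i => Set.mem_iInter.1 hP i⟩

/-- The probability measures on `Y × Y` with first marginal `m`. -/
abbrev FstMarginal {Y : Type*} [MeasurableSpace Y] (m : Measure Y) : Type _ :=
  {P : ProbabilityMeasure (Y × Y) // (P : Measure (Y × Y)).fst = m}

lemma integrable_comp_fst_of_fst_eq {Y : Type*} [MeasurableSpace Y] {m : Measure Y} {φ : Y → ℝ} (hφ : Integrable φ m)
    (P : FstMarginal m) : Integrable (fun q : Y × Y => φ q.1) (P.1 : Measure (Y × Y)) := by
  have h := P.2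
  rw [← h] at hφ
  exact hφ.comp_measurable measurable_fst

section Coupling

variable {Y : Type*} [MetricSpace Y] [CompactSpace Y] [MeasurableSpace Y] [BorelSpace Y]

instance (m : Measure Y) [IsProbabilityMeasure m] : CompactSpace (FstMarginal m) := by
  let m' : ProbabilityMeasure Y := ⟨m, inferInstance⟩
  have hcl : IsClosed {P : ProbabilityMeasure (Y × Y) | (P : Measure (Y × Y)).fst = m} := by
    have : {P : ProbabilityMeasure (Y × Y) | (P : Measure (Y × Y)).fst = m} =
        {P | P.map (continuous_fst.measurable.aemeasurable (μ := (P : Measure (Y × Y)))) = m'} := by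
      ext P
      simp only [Set.mem_ofPred_eq, ← ProbabilityMeasure.toMeasure_injective.eq_iff]
      rfl
    rw [this]
    exact isClosed_eq (ProbabilityMeasure.continuous_map continuous_fst) continuous_const
  exact isCompact_iff_compactSpace.1 hcl.isCompact

lemma integrable_mul_of_fst_eq {m : Measure Y} {φ : Y → ℝ} (hφ : Integrable φ m) (f : C(Y, ℝ))
    (P : FstMarginal m) :
    Integrable (fun q : Y × Y => φ q.1 * f q.2) (P.1 : Measure (Y × Y)) :=
  (integrable_comp_fst_of_fst_eq hφ P).mul_bdd (c := ‖f‖)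
    (by fun_prop) (.of_forall fun q => f.norm_coe_le_norm q.2)

/-- Integration of `φ(y) f(u)` with `φ` integrable and `f` continuous is weakly continuous on
measures with fixed first marginal. -/
lemma continuous_integral_mul_fstMarginal (m : Measure Y) [IsProbabilityMeasure m] {φ : Y → ℝ}
    (hφ : Integrable φ m) (f : C(Y, ℝ)) :
    Continuous fun P : FstMarginal m => ∫ q, φ q.1 * f q.2 ∂(P.1 : Measure (Y × Y)) := by
  refine continuous_of_uniform_approx_of_continuous fun u hu => ?_
  obtain ⟨ε, hε, hεu⟩ := Metric.mem_uniformity_dist.1 hu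
  have hf : 0 < ‖f‖ + 1 := by positivity
  obtain ⟨g, hg, hgi⟩ := hφ.exists_boundedContinuous_integral_sub_le
    (ε := ε / 2 / (‖f‖ + 1)) (by positivity)
  let h : C(Y × Y, ℝ) := ⟨fun q => g q.1 * f q.2, by fun_prop⟩
  refine ⟨fun P => ∫ q, g q.1 * f q.2 ∂(P.1 : Measure (Y × Y)),
    (ProbabilityMeasure.continuous_integral_continuousMap h).comp continuous_subtype_val,
    fun P => hεu ?_⟩
  rw [dist_eq_norm, ← integral_sub (integrable_mul_of_fst_eq hφ f P)
    (integrable_mul_of_fst_eq hgi f P)]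
  have hd := integrable_comp_fst_of_fst_eq (hφ.sub hgi).norm P
  calc ‖∫ q, φ q.1 * f q.2 - g q.1 * f q.2 ∂(P.1 : Measure (Y × Y))‖
      ≤ ∫ q, ‖φ q.1 - g q.1‖ * (‖f‖ + 1) ∂(P.1 : Measure (Y × Y)) := by
        refine norm_integral_le_of_norm_le (hd.mul_const _) (.of_forall fun q => ?_)
        rw [← sub_mul, norm_mul]
        gcongr
        exact (f.norm_coe_le_norm q.2).trans (by linarith)
    _ = (∫ y, ‖φ y - g y‖ ∂m) * (‖f‖ + 1) := by
        rw [integral_mul_const]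
        congr 1
        have h := P.2
        have hm : AEStronglyMeasurable (fun y => ‖φ y - g y‖) (P.1 : Measure (Y × Y)).fst := by
          rw [h]
          exact (hφ.sub hgi).norm.aestronglyMeasurable
        conv_rhs => rw [← h]
        exact (integral_map measurable_fst.aemeasurable hm).symm
    _ ≤ ε / 2 / (‖f‖ + 1) * (‖f‖ + 1) := by gcongr
    _ < ε := by rw [div_mul_cancel₀ _ hf.ne']; linarith

/-- Convex combinations of measures with first marginal `m`. -/
lemma exists_fstMarginal_convexComb (m : Measure Y) (P Q : FstMarginal m) {a b : ℝ} (ha : 0 ≤ a)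
    (hb : 0 ≤ b) (hab : a + b = 1) :
    ∃ R : FstMarginal m, ∀ (φ : Y → ℝ) (f : C(Y, ℝ)), Integrable φ m →
      ∫ q, φ q.1 * f q.2 ∂(R.1 : Measure (Y × Y)) =
        a * ∫ q, φ q.1 * f q.2 ∂(P.1 : Measure (Y × Y)) +
          b * ∫ q, φ q.1 * f q.2 ∂(Q.1 : Measure (Y × Y)) := by
  have hab' : ENNReal.ofReal a + ENNReal.ofReal b = 1 := by
    rw [← ENNReal.ofReal_add ha hb, hab, ENNReal.ofReal_one]
  let ρ : Measure (Y × Y) :=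
    ENNReal.ofReal a • (P.1 : Measure (Y × Y)) + ENNReal.ofReal b • (Q.1 : Measure (Y × Y))
  have hρ : IsProbabilityMeasure ρ := ⟨by simp [ρ, hab']⟩
  have hρm : ρ.fst = m := by
    ext B hB
    have hP := congrArg (· B) P.2
    have hQ := congrArg (· B) Q.2
    simp only [Measure.fst_apply hB] at hP hQ
    simp [ρ, Measure.fst_apply hB, hP, hQ, ← add_mul, hab']
  refine ⟨⟨⟨ρ, hρ⟩, hρm⟩, fun φ f hφ => ?_⟩
  change ∫ q, φ q.1 * f q.2 ∂ρ = _
  rw [integral_add_measure ((integrable_mul_of_fst_eq hφ f P).smul_measure ENNReal.ofReal_ne_top)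
    ((integrable_mul_of_fst_eq hφ f Q).smul_measure ENNReal.ofReal_ne_top),
    integral_smul_measure, integral_smul_measure, ENNReal.toReal_ofReal ha,
    ENNReal.toReal_ofReal hb, smul_eq_mul, smul_eq_mul]

lemma integral_slice_eq_integral_compProd {X : Type*} [MeasurableSpace X] (μ : Measure (X × Y))
    [IsProbabilityMeasure μ] (A : Set X) (f : C(Y, ℝ)) (κ : Kernel Y Y) [IsMarkovKernel κ] :
    ∫ y, ∫ u, f u ∂κ y ∂μ.slice A =
      ∫ q, ((μ.slice A).rnDeriv μ.snd q.1).toReal * f q.2 ∂(μ.snd ⊗ₘ κ) := by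
  rw [Measure.integral_compProd]
  · simp_rw [integral_const_mul]
    exact (integral_rnDeriv_smul (μ.slice_absolutelyContinuous A)).symm
  · let P : FstMarginal μ.snd := ⟨⟨μ.snd ⊗ₘ κ, inferInstance⟩, Measure.fst_compProd _ _⟩
    exact integrable_mul_of_fst_eq Measure.integrable_toReal_rnDeriv f P

end Coupling

/-- Every bound on the costs of all `Y`-valued randomized policies under `μ` bounds the cost of
the identity policy under `ν`. -/
lemma le_integral_of_forall_kernel {X Y : Type*} [MeasurableSpace X]
    [MetricSpace Y] [CompactSpace Y] [Nonempty Y] [MeasurableSpace Y] [BorelSpace Y]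
    {μ ν : Measure (X × Y)} [IsProbabilityMeasure ν]
    (hinfo : ∀ (U : Type) [MetricSpace U] [CompactSpace U] [Nonempty U]
      [MeasurableSpace U] [BorelSpace U], ∀ c : X → U → ℝ,
      (∃ M : ℝ, ∀ x u, |c x u| ≤ M) →
      (Measurable fun p : X × U => c p.1 p.2) →
      (∀ x, Continuous fun u : U => c x u) →
      (⨅ γ : {κ : Kernel Y U // IsMarkovKernel κ}, ∫ p, ∫ u, c p.1 u ∂(γ.1 p.2) ∂μ) ≤
        ⨅ γ : {κ : Kernel Y U // IsMarkovKernel κ}, ∫ p, ∫ u, c p.1 u ∂(γ.1 p.2) ∂ν)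
    {c : X → Y → ℝ} {M : ℝ} (hM : ∀ x u, |c x u| ≤ M)
    (hc : Measurable fun p : X × Y => c p.1 p.2) (hcont : ∀ x, Continuous (c x)) {w : ℝ}
    (hw : ∀ κ : Kernel Y Y, IsMarkovKernel κ → w ≤ ∫ p, ∫ u, c p.1 u ∂κ p.2 ∂μ) :
    w ≤ ∫ p, c p.1 p.2 ∂ν := by
  let Z : Type := Set.range (kuratowskiEmbedding Y)
  let e : Y ≃ₜ Z := (kuratowskiEmbedding.isometry Y).isEmbedding.toHomeomorph
  have : CompactSpace Z := e.compactSpace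
  have : Nonempty Z := e.symm.surjective.nonempty
  let : MeasurableSpace Z := borel Z
  have : BorelSpace Z := ⟨rfl⟩
  have he : Measurable e := e.continuous.measurable
  have hes : Measurable e.symm := e.symm.continuous.measurable
  have hcZ : Measurable fun p : X × Z => c p.1 (e.symm p.2) :=
    hc.comp (measurable_fst.prodMk (hes.comp measurable_snd))
  have hle := hinfo Z (fun x z => c x (e.symm z)) ⟨M, fun x u => hM _ _⟩ hcZ
    fun x => (hcont x).comp e.symm.continuous
  have hid : IsMarkovKernel (Kernel.deterministic e he) := inferInstance
  have : Nonempty {κ : Kernel Y Z // IsMarkovKernel κ} := ⟨⟨_, hid⟩⟩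
  have hbdd : BddBelow (Set.range fun γ : {κ : Kernel Y Z // IsMarkovKernel κ} =>
      ∫ p, ∫ u, c p.1 (e.symm u) ∂(γ.1 p.2) ∂ν) := by
    refine ⟨-M, ?_⟩
    rintro _ ⟨⟨γ, hγ⟩, rfl⟩
    have h1 : ∀ p : X × Y, ‖∫ u, c p.1 (e.symm u) ∂(γ p.2)‖ ≤ M := fun p => by
      simpa using norm_integral_le_of_norm_le_const (μ := γ p.2)
        (f := fun u => c p.1 (e.symm u)) (.of_forall fun u => hM p.1 (e.symm u))
    have h2 := norm_integral_le_of_norm_le_const (μ := ν) (.of_forall h1)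
    simp only [probReal_univ, mul_one] at h2
    exact (abs_le.1 h2).1
  calc w ≤ ⨅ γ : {κ : Kernel Y Z // IsMarkovKernel κ},
        ∫ p, ∫ u, c p.1 (e.symm u) ∂(γ.1 p.2) ∂μ := by
        refine le_ciInf fun ⟨γ, hγ⟩ => ?_
        refine (hw (γ.map e.symm) (Kernel.IsMarkovKernel.map γ hes)).trans_eq (integral_congr_ae (.of_forall fun p => ?_))
        simp only [Kernel.map_apply γ hes]
        exact integral_map hes.aemeasurable (hcont _).aestronglyMeasurable
    _ ≤ _ := hle
    _ ≤ _ := ciInf_le hbdd ⟨_, hid⟩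
    _ = _ := by
        refine integral_congr_ae (.of_forall fun p => ?_)
        have hm : StronglyMeasurable fun z => c p.1 (e.symm z) :=
          ((hcont _).comp e.symm.continuous).stronglyMeasurable
        simp [Kernel.deterministic_apply, integral_dirac' _ _ hm]

/-- Expected cost of a finite combination of product costs `1_A(x) f(u)`. -/
lemma integral_sum_indicator_mul {X Y ι : Type*} [MeasurableSpace X] [MetricSpace Y]
    [CompactSpace Y] [MeasurableSpace Y] [BorelSpace Y] (μ : Measure (X × Y))
    [IsProbabilityMeasure μ] [Fintype ι] (l : ι → ℝ) {A : ι → Set X}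
    (hA : ∀ i, MeasurableSet (A i)) (f : ι → C(Y, ℝ)) (κ : Kernel Y Y) [IsMarkovKernel κ] :
    ∫ p, ∫ u, ∑ i, l i * ((A i).indicator 1 p.1 * f i u) ∂κ p.2 ∂μ =
      ∑ i, l i * ∫ y, ∫ u, f i u ∂κ y ∂μ.slice (A i) := by
  have hf : ∀ i y, Integrable (f i) (κ y) := fun i y =>
    (integrable_const ‖f i‖).mono' (by fun_prop) (.of_forall (f i).norm_coe_le_norm)
  have hm : ∀ i, StronglyMeasurable fun y => ∫ u, f i u ∂κ y := fun i =>
    (f i).continuous.stronglyMeasurable.integral_kernel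
  have hb : ∀ i y, ‖∫ u, f i u ∂κ y‖ ≤ ‖f i‖ := fun i y => by
    simpa using norm_integral_le_of_norm_le_const (μ := κ y) (.of_forall (f i).norm_coe_le_norm)
  have hinner : ∀ p : X × Y, ∫ u, ∑ i, l i * ((A i).indicator 1 p.1 * f i u) ∂κ p.2 =
      ∑ i, l i * ((A i).indicator 1 p.1 * ∫ u, f i u ∂κ p.2) := fun p => by
    rw [integral_finsetSum _ fun i _ => ((hf i p.2).const_mul _).const_mul _]
    simp_rw [integral_const_mul]
  simp_rw [hinner]
  rw [integral_finsetSum]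
  · simp_rw [integral_const_mul, μ.integral_slice (hA _) (hm _)]
  · refine fun i _ => Integrable.const_mul ?_ _
    refine (integrable_const ‖f i‖).mono' ?_ (.of_forall fun p => ?_)
    · exact ((measurable_one.indicator (hA i)).comp measurable_fst).aestronglyMeasurable.mul
        ((hm i).comp_measurable measurable_snd).aestronglyMeasurable
    · by_cases h : p.1 ∈ A i
      · simpa [h] using hb i p.2
      · simp [h]

/-- Partial converse to Blackwell's ordering in the standard Borel setup.
If `μ` and `ν` are information structures on `X × Y` (with `X`-marginal `ζ`, `Y` a nonempty
compact metric space) that are absolutely continuous with respect to product reference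
measures, and `μ` is more informative than `ν` over all single-player decision problems
with nonempty compact metric action spaces and bounded measurable costs continuous in the
action, then `ν` is a garbling of `μ`. -/
theorem partial_converse_blackwell
    {X Y : Type*} [MeasurableSpace X] [StandardBorelSpace X]
    [MetricSpace Y] [CompactSpace Y] [Nonempty Y] [MeasurableSpace Y] [BorelSpace Y]
    (ζ : Measure X) [IsProbabilityMeasure ζ]
    (μ ν : Measure (X × Y)) [IsProbabilityMeasure μ] [IsProbabilityMeasure ν]
    (hμmarg : μ.map Prod.fst = ζ) (hνmarg : ν.map Prod.fst = ζ)
    (hμac : ∃ Qμ : Measure Y, IsProbabilityMeasure Qμ ∧ μ ≪ ζ.prod Qμ)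
    (hνac : ∃ Qν : Measure Y, IsProbabilityMeasure Qν ∧ ν ≪ ζ.prod Qν)
    (hinfo : ∀ (U : Type) [MetricSpace U] [CompactSpace U] [Nonempty U]
      [MeasurableSpace U] [BorelSpace U], ∀ c : X → U → ℝ,
      (∃ M : ℝ, ∀ x u, |c x u| ≤ M) →
      (Measurable fun p : X × U => c p.1 p.2) →
      (∀ x, Continuous fun u : U => c x u) →
      (⨅ γ : {κ : Kernel Y U // IsMarkovKernel κ}, ∫ p, ∫ u, c p.1 u ∂(γ.1 p.2) ∂μ) ≤
        ⨅ γ : {κ : Kernel Y U // IsMarkovKernel κ}, ∫ p, ∫ u, c p.1 u ∂(γ.1 p.2) ∂ν) :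
    ∃ κ : Kernel Y Y, IsMarkovKernel κ ∧
      ∀ A : Set X, ∀ B : Set Y, MeasurableSet A → MeasurableSet B →
        ν (A ×ˢ B) = ∫⁻ p in A ×ˢ (Set.univ : Set Y), κ p.2 B ∂μ := by
  let ι := {A : Set X // MeasurableSet A} × C(Y, ℝ)
  let m := μ.snd
  let F : ι → FstMarginal m → ℝ := fun i P =>
    ∫ q, ((μ.slice i.1.1).rnDeriv m q.1).toReal * i.2 q.2 ∂(P.1 : Measure (Y × Y))
  obtain ⟨P, hP⟩ : ∃ P, ∀ i, F i P = ∫ y, i.2 y ∂ν.slice i.1.1 := by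
    refine exists_forall_eq_of_not_separated F
      (fun i => continuous_integral_mul_fstMarginal m Measure.integrable_toReal_rnDeriv i.2)
      (fun P Q a b ha hb hab => ?_) _ fun s l w hw => ?_
    · obtain ⟨R, hR⟩ := exists_fstMarginal_convexComb m P Q ha hb hab
      exact ⟨R, fun i => hR _ i.2 Measure.integrable_toReal_rnDeriv⟩
    · have hA : ∀ i : s, MeasurableSet i.1.1.1 := fun i => i.1.1.2
      have hν : ∑ i, l i * ∫ y, i.1.2 y ∂ν.slice i.1.1.1 =
          ∫ p, ∑ i, l i * ((i.1.1.1).indicator 1 p.1 * i.1.2 p.2) ∂ν := by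
        have h := integral_sum_indicator_mul ν l hA (fun i => i.1.2) Kernel.id
        simpa [Kernel.id_apply] using h.symm
      rw [hν]
      refine le_integral_of_forall_kernel (M := ∑ i, |l i| * ‖i.1.2‖)
        (c := fun x u => ∑ i, l i * ((i.1.1.1).indicator 1 x * i.1.2 u)) hinfo ?_ ?_ ?_ ?_
      · refine fun x u => (Finset.abs_sum_le_sum_abs _ _).trans (Finset.sum_le_sum fun i _ => ?_)
        rw [abs_mul]
        gcongr
        by_cases h : x ∈ i.1.1.1
        · simpa [h] using i.1.2.norm_coe_le_norm u
        · simp [h]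
      · refine Finset.measurable_sum _ fun i _ => Measurable.const_mul ?_ _
        exact ((measurable_one.indicator (hA i)).comp measurable_fst).mul
          (i.1.2.continuous.measurable.comp measurable_snd)
      · exact fun x => continuous_finsetSum _ fun i _ =>
          continuous_const.mul (continuous_const.mul i.1.2.continuous)
      · intro κ hκ
        rw [integral_sum_indicator_mul μ l hA (fun i => i.1.2) κ]
        simp_rw [integral_slice_eq_integral_compProd]
        exact hw ⟨⟨m ⊗ₘ κ, inferInstance⟩, Measure.fst_compProd _ _⟩
  let ρ : Measure (Y × Y) := P.1
  have hρ : m ⊗ₘ ρ.condKernel = ρ := by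
    have h := ρ.disintegrate ρ.condKernel
    rwa [P.2] at h
  refine ⟨ρ.condKernel, inferInstance, fun A B hA hB => ?_⟩
  have hslice : (μ.slice A ⊗ₘ ρ.condKernel).snd = ν.slice A := by
    refine ext_of_forall_integral_eq_of_IsFiniteMeasure fun f => ?_
    have h := hP (⟨A, hA⟩, f.toContinuousMap)
    have hf : Integrable (fun q : Y × Y => f q.2) (μ.slice A ⊗ₘ ρ.condKernel) :=
      (integrable_const ‖f‖).mono' (by fun_prop) (.of_forall fun q => f.norm_coe_le_norm q.2)
    rw [Measure.snd, integral_map measurable_snd.aemeasurable (by fun_prop),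
      Measure.integral_compProd hf]
    refine .trans ?_ h
    refine (integral_slice_eq_integral_compProd μ A f.toContinuousMap ρ.condKernel).trans ?_
    rw [hρ]
  rw [← ν.slice_apply A hB, ← hslice, Measure.snd_compProd, Measure.bind_apply hB (by fun_prop),
    μ.lintegral_slice A (Kernel.measurable_coe _ hB)]
end
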